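/- Weighted Hardy inequality: for d ≥ 2 and every ψ ∈ C_0^∞(ℝ^d), ∫_{ℝ^d} |x| |∇ψ(x)|² dx ≥ ((d−1)²/4) ∫_{ℝ^d} |ψ(x)|²/|x| dx. -/

import Mathlib

open MeasureTheory Filter Topology

/-- The integral of a directional derivative of a compactly supported `C¹` function vanishes. -/
theorem integral_fderiv_apply_eq_zero_of_hasCompactSupport {E : Type*} [NormedAddCommGroup E]
    [NormedSpace ℝ E] [FiniteDimensional ℝ E] [MeasurableSpace E] [BorelSpace E]
    (μ : Measure E) [μ.IsAddHaarMeasure] {h : E → ℝ}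
    (hh : ContDiff ℝ 1 h) (hc : HasCompactSupport h) (v : E) :
    ∫ x, fderiv ℝ h x v ∂μ = 0 := by
  have hi : Integrable (fun x => fderiv ℝ h x v) μ :=
    ((hh.continuous_fderiv one_ne_zero).clm_apply continuous_const).integrable_of_hasCompactSupport
      (hc.fderiv_apply (𝕜 := ℝ) v)
  have key := integral_mul_fderiv_eq_neg_fderiv_mul_of_integrable (μ := μ) (𝕜 := ℝ)
    (f := fun _ : E => (1 : ℝ)) (g := h) (v := v) (by simp) (by simpa using hi)
    (by simpa using hh.continuous.integrable_of_hasCompactSupport hc)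
    (fun x _ => differentiableAt_const _) (fun x _ => hh.differentiable one_ne_zero x)
  simpa using key

theorem hasFDerivAt_sqrt_norm_sq_add {E : Type*} [NormedAddCommGroup E] [InnerProductSpace ℝ E]
    {ε : ℝ} (hε : 0 < ε) (x : E) :
    HasFDerivAt (fun y : E => √(‖y‖ ^ 2 + ε)) ((√(‖x‖ ^ 2 + ε))⁻¹ • innerSL ℝ x) x := by
  have hpos : ‖x‖ ^ 2 + ε ≠ 0 := by positivity
  have h := ((hasStrictFDerivAt_norm_sq x).hasFDerivAt.add_const ε).sqrt hpos
  refine h.congr_fderiv ?_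
  ext v
  simp
  field_simp

/-- The divergence of `(x / √(|x|² + ε)) |ψ|²`, one summand at a time. -/
theorem fderiv_coord_div_sqrt_mul_norm_sq {d : ℕ} {ψ : EuclideanSpace ℝ (Fin d) → ℂ}
    {ε : ℝ} (hε : 0 < ε) {x : EuclideanSpace ℝ (Fin d)} (hψ : DifferentiableAt ℝ ψ x)
    (k : Fin d) :
    fderiv ℝ (fun y => y k / √(‖y‖ ^ 2 + ε) * ‖ψ y‖ ^ 2) x (EuclideanSpace.single k (1 : ℝ)) =
      (1 / √(‖x‖ ^ 2 + ε) - x k ^ 2 / √(‖x‖ ^ 2 + ε) ^ 3) * ‖ψ x‖ ^ 2 +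
        2 / √(‖x‖ ^ 2 + ε) *
          (x k * inner ℝ (ψ x) (fderiv ℝ ψ x (EuclideanSpace.single k (1 : ℝ)))) := by
  have hq : 0 < √(‖x‖ ^ 2 + ε) := Real.sqrt_pos.2 (by positivity)
  have h1 : HasFDerivAt (fun y : EuclideanSpace ℝ (Fin d) => y k)
      (EuclideanSpace.proj k : EuclideanSpace ℝ (Fin d) →L[ℝ] ℝ) x :=
    (EuclideanSpace.proj k : EuclideanSpace ℝ (Fin d) →L[ℝ] ℝ).hasFDerivAt
  have h2 := (h1.fun_mul ((hasDerivAt_inv hq.ne').comp_hasFDerivAt x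
    (hasFDerivAt_sqrt_norm_sq_add hε x))).fun_mul hψ.hasFDerivAt.norm_sq
  simp only [Function.comp_apply, ← div_eq_mul_inv] at h2
  rw [h2.fderiv]
  simp [EuclideanSpace.inner_single_right]
  field_simp
  ring

/-- The scalar inequality behind the Hardy inequality: expand the square and use Cauchy-Schwarz. -/
theorem hardy_pointwise_aux {N q f s T c : ℝ} (hN : 0 ≤ N) (hq : 0 < q) (hNq : N ≤ q)
    (hf : 0 ≤ f) (hs : 0 ≤ s) (hc : 0 < c) (hT : T ^ 2 ≤ N ^ 2 * (f * s)) :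
    c * (f / q) - c⁻¹ * (N * s) ≤ ((2 * c + 1) / q - N ^ 2 / q ^ 3) * f + 2 / q * T := by
  have h1 : N ^ 2 / q ^ 3 ≤ 1 / q := by
    rw [div_le_div_iff₀ (by positivity) hq]
    have : N ^ 2 ≤ q ^ 2 := by gcongr
    nlinarith
  have h2 : -(c * f + c⁻¹ * (N ^ 2 * s)) ≤ 2 * T := by
    have h : (2 * T) ^ 2 ≤ (c * f + c⁻¹ * (N ^ 2 * s)) ^ 2 := by
      have e : (c * f) * (c⁻¹ * (N ^ 2 * s)) = N ^ 2 * (f * s) := by field_simp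
      nlinarith [sq_nonneg (c * f - c⁻¹ * (N ^ 2 * s))]
    exact (abs_le.1 (abs_le_of_sq_le_sq h (by positivity))).1
  have h3 : N ^ 2 * s / q ≤ N * s := by
    rw [div_le_iff₀ hq]
    nlinarith [mul_le_mul_of_nonneg_left hNq (mul_nonneg hN hs)]
  have h4 : -(c * f + c⁻¹ * (N ^ 2 * s)) / q ≤ 2 * T / q := by gcongr
  have h5 : (1 / q - N ^ 2 / q ^ 3) * f ≥ 0 := mul_nonneg (by linarith) hf
  have h6 : c⁻¹ * (N ^ 2 * s / q) ≤ c⁻¹ * (N * s) := by gcongr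
  have e1 : -(c * f + c⁻¹ * (N ^ 2 * s)) / q = -(c * (f / q)) - c⁻¹ * (N ^ 2 * s / q) := by ring
  have e2 : ((2 * c + 1) / q - N ^ 2 / q ^ 3) * f + 2 / q * T =
      2 * (c * (f / q)) + (1 / q - N ^ 2 / q ^ 3) * f + 2 * T / q := by ring
  rw [e2]
  linarith

theorem sq_sum_coord_mul_inner_le {d : ℕ} (x : EuclideanSpace ℝ (Fin d)) (u : ℂ)
    (v : Fin d → ℂ) :
    (∑ k, x k * inner ℝ u (v k)) ^ 2 ≤ ‖x‖ ^ 2 * (‖u‖ ^ 2 * ∑ k, ‖v k‖ ^ 2) := by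
  refine (Finset.sum_mul_sq_le_sq_mul_sq _ _ _).trans ?_
  rw [EuclideanSpace.real_norm_sq_eq, Finset.mul_sum _ _ (‖u‖ ^ 2)]
  refine mul_le_mul_of_nonneg_left (Finset.sum_le_sum fun k _ => ?_) (by positivity)
  rw [← mul_pow, ← sq_abs]
  gcongr
  exact abs_real_inner_le_norm _ _

/-- The weighted Hardy inequality with the singular weight `1 / |x|` replaced by
`1 / √(|x|² + ε)`. -/
theorem weighted_hardy_inequality_regularized {d : ℕ} {c : ℝ} (hc : 0 < c)
    (hcd : (d : ℝ) = 2 * c + 1) {ψ : EuclideanSpace ℝ (Fin d) → ℂ}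
    (hψ : ContDiff ℝ 1 ψ) (hsupp : HasCompactSupport ψ) {ε : ℝ} (hε : 0 < ε) :
    c ^ 2 * ∫ x, ‖ψ x‖ ^ 2 / √(‖x‖ ^ 2 + ε) ≤
      ∫ x, ‖x‖ * ∑ k, ‖fderiv ℝ ψ x (EuclideanSpace.single k (1 : ℝ))‖ ^ 2 := by
  have hpos (x : EuclideanSpace ℝ (Fin d)) : 0 < √(‖x‖ ^ 2 + ε) := Real.sqrt_pos.2 (by positivity)
  have hdψ : Continuous (fderiv ℝ ψ) := hψ.continuous_fderiv one_ne_zero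
  have hsq : HasCompactSupport (fun x => ‖ψ x‖ ^ 2) :=
    hsupp.comp_left (g := fun z : ℂ => ‖z‖ ^ 2) (by simp)
  have hsmooth (k : Fin d) : ContDiff ℝ 1
      (fun y : EuclideanSpace ℝ (Fin d) => y k / √(‖y‖ ^ 2 + ε) * ‖ψ y‖ ^ 2) := by
    refine ContDiff.mul (ContDiff.div ?_ ?_ fun x => (hpos x).ne') (hψ.norm_sq ℝ)
    · exact (EuclideanSpace.proj k : EuclideanSpace ℝ (Fin d) →L[ℝ] ℝ).contDiff
    · exact ((contDiff_norm_sq ℝ).add contDiff_const).sqrt fun x => by positivity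
  have hcs (k : Fin d) : HasCompactSupport
      (fun y : EuclideanSpace ℝ (Fin d) => y k / √(‖y‖ ^ 2 + ε) * ‖ψ y‖ ^ 2) := hsq.mul_left
  have hG (k : Fin d) : Integrable (fun x => fderiv ℝ
      (fun y : EuclideanSpace ℝ (Fin d) => y k / √(‖y‖ ^ 2 + ε) * ‖ψ y‖ ^ 2) x
      (EuclideanSpace.single k (1 : ℝ))) :=
    (((hsmooth k).continuous_fderiv one_ne_zero).clm_apply
      continuous_const).integrable_of_hasCompactSupport ((hcs k).fderiv_apply (𝕜 := ℝ) _)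
  have hI1 : Integrable (fun x => ‖ψ x‖ ^ 2 / √(‖x‖ ^ 2 + ε)) := by
    refine Continuous.integrable_of_hasCompactSupport ?_ ?_
    · exact (hψ.continuous.norm.pow 2).div (by fun_prop) fun x => (hpos x).ne'
    · simp only [div_eq_mul_inv]
      exact hsq.mul_right
  have hI2 : Integrable (fun x : EuclideanSpace ℝ (Fin d) =>
      ‖x‖ * ∑ k, ‖fderiv ℝ ψ x (EuclideanSpace.single k (1 : ℝ))‖ ^ 2) := by
    refine Continuous.integrable_of_hasCompactSupport (by fun_prop) (HasCompactSupport.mul_left ?_)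
    exact (hsupp.fderiv (𝕜 := ℝ)).comp_left (g := fun L : EuclideanSpace ℝ (Fin d) →L[ℝ] ℂ =>
      ∑ k, ‖L (EuclideanSpace.single k (1 : ℝ))‖ ^ 2) (by simp)
  have hle := integral_mono ((hI1.const_mul c).sub (hI2.const_mul c⁻¹))
    (integrable_finsetSum Finset.univ fun k _ => hG k) fun x => ?_
  · rw [integral_finsetSum _ fun k _ => hG k] at hle
    simp only [Pi.sub_apply] at hle
    rw [integral_sub (hI1.const_mul c) (hI2.const_mul c⁻¹), integral_const_mul,
      integral_const_mul, Finset.sum_eq_zero fun k _ =>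
      integral_fderiv_apply_eq_zero_of_hasCompactSupport _ (hsmooth k) (hcs k) _] at hle
    have := mul_le_mul_of_nonneg_left (sub_nonpos.1 hle) hc.le
    rwa [← mul_assoc, ← mul_assoc, mul_inv_cancel₀ hc.ne', one_mul, ← sq] at this
  · simp only [Pi.sub_apply]
    simp_rw [fderiv_coord_div_sqrt_mul_norm_sq hε (hψ.differentiable one_ne_zero x)]
    rw [Finset.sum_add_distrib, ← Finset.mul_sum, ← Finset.sum_mul, Finset.sum_sub_distrib,
      ← Finset.sum_div _ fun k => x k ^ 2, ← EuclideanSpace.real_norm_sq_eq]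
    simp only [Finset.sum_const, Finset.card_univ, Fintype.card_fin, nsmul_eq_mul, mul_one_div]
    rw [hcd]
    exact hardy_pointwise_aux (norm_nonneg x) (hpos x) (Real.le_sqrt_of_sq_le (by linarith))
      (by positivity) (by positivity) hc (sq_sum_coord_mul_inner_le _ _ _)


/-- Weighted Hardy inequality in dimension `d ≥ 2`:
`∫ |x| |∇ψ|² ≥ ((d−1)²/4) ∫ |ψ|²/|x|`. -/
theorem weighted_hardy_inequality (d : ℕ) (hd : 2 ≤ d)
    (ψ : EuclideanSpace ℝ (Fin d) → ℂ)
    (hψ : ContDiff ℝ (⊤ : ℕ∞) ψ) (hsupp : HasCompactSupport ψ) :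
    ∫ x : EuclideanSpace ℝ (Fin d),
        ‖x‖ * ∑ k, ‖fderiv ℝ ψ x (EuclideanSpace.single k (1 : ℝ))‖ ^ 2
      ≥ (((d : ℝ) - 1) ^ 2 / 4) *
        ∫ x : EuclideanSpace ℝ (Fin d), ‖ψ x‖ ^ 2 / ‖x‖ := by
  set c : ℝ := ((d : ℝ) - 1) / 2 with hc_def
  have hd' : (2 : ℝ) ≤ d := by exact_mod_cast hd
  have hc : 0 < c := by rw [hc_def]; linarith
  have hψ1 : ContDiff ℝ 1 ψ := hψ.of_le (by exact_mod_cast le_top)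
  rw [ge_iff_le, show ((d : ℝ) - 1) ^ 2 / 4 = c ^ 2 by rw [hc_def]; ring]
  by_cases hint : Integrable (fun x => ‖ψ x‖ ^ 2 / ‖x‖)
  · have : Nonempty (Fin d) := ⟨⟨0, by omega⟩⟩
    have hae : ∀ᵐ x : EuclideanSpace ℝ (Fin d), x ≠ 0 := by
      simp [ae_iff]
    have hlim : Tendsto (fun n : ℕ => ∫ x, ‖ψ x‖ ^ 2 / √(‖x‖ ^ 2 + 1 / ((n : ℝ) + 1))) atTop
        (𝓝 (∫ x, ‖ψ x‖ ^ 2 / ‖x‖)) := by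
      refine tendsto_integral_of_dominated_convergence _ (fun n => ?_) hint (fun n => ?_) ?_
      · refine (Continuous.div (hψ.continuous.norm.pow 2) (by fun_prop)
          fun x => ?_).aestronglyMeasurable
        exact (Real.sqrt_pos.2 (by positivity)).ne'
      · filter_upwards [hae] with x hx
        rw [Real.norm_of_nonneg (by positivity)]
        have := norm_pos_iff.2 hx
        gcongr
        exact Real.le_sqrt_of_sq_le (by linarith [Nat.one_div_pos_of_nat (α := ℝ) (n := n)])
      · filter_upwards [hae] with x hx
        refine tendsto_const_nhds.div ?_ (norm_ne_zero_iff.2 hx)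
        have h := ((tendsto_const_nhds (x := ‖x‖ ^ 2)).add
          (tendsto_one_div_add_atTop_nhds_zero_nat (𝕜 := ℝ))).sqrt
        simpa using h
    exact le_of_tendsto' (hlim.const_mul (c ^ 2)) fun n =>
      weighted_hardy_inequality_regularized hc (by rw [hc_def]; ring) hψ1 hsupp
        Nat.one_div_pos_of_nat
  · rw [integral_undef hint, mul_zero]
    exact integral_nonneg fun x => by positivity
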